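/- arXiv:1709.04144 — 2 statements merged into one kernel-verified Lean document; each statement's English description precedes it below -/
import Mathlib

section
/- Let α, β ∈ (0,1) be real numbers with α + β ≠ 1. Then for every real t ∈ (0,1) one has the linear relation B(α,β)·₂F₁(α, β; α+β; t) + 2πi·((1−e^{2πi(α+β)})/((1−e^{2πiα})(1−e^{2πiβ})))·₂F₁(α, β; 1; 1−t) − B(1−α,1−β)·t^{1−α−β}·₂F₁(1−α, 1−β; 2−α−β; t) = 0 (an identity of complex numbers), where t^{1−α−β} denotes the real power. -/
open Set Complex

/-- Pochhammer symbol `(a)_n` for complex `a`. -/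
noncomputable def pochC (a : ℂ) (n : ℕ) : ℂ := (ascPochhammer ℂ n).eval a

/-- Gauss hypergeometric function `₂F₁(a,b;c;x)` as a series (complex version). -/
noncomputable def hyp2F1C (a b c x : ℂ) : ℂ :=
  ∑' n : ℕ, pochC a n * pochC b n / (pochC c n * (n.factorial : ℂ)) * x ^ n

/-- Beta function `B(a,b) = Γ(a)Γ(b)/Γ(a+b)` (complex version). -/
noncomputable def betaC (a b : ℂ) : ℂ :=
  Complex.Gamma a * Complex.Gamma b / Complex.Gamma (a + b)

open Filter Topology

/-- The sum of the power series with coefficients `u`. -/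
noncomputable def powSum (u : ℕ → ℝ) (x : ℝ) : ℝ := ∑' n, u n * x ^ n

/-- The coefficients of the termwise derivative of a power series. -/
def derivCoeff (u : ℕ → ℝ) (n : ℕ) : ℝ := (n + 1) * u (n + 1)

/-- Sequences of at most polynomial growth. -/
def PolyGrowth (u : ℕ → ℝ) : Prop := ∃ (K : ℝ) (k : ℕ), ∀ n : ℕ, |u n| ≤ K * ((n : ℝ) + 1) ^ k

theorem PolyGrowth.derivCoeff {u : ℕ → ℝ} (hu : PolyGrowth u) : PolyGrowth (derivCoeff u) := by
  obtain ⟨K, k, h⟩ := hu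
  have hK : 0 ≤ K := by simpa using (abs_nonneg _).trans (h 0)
  refine ⟨K * 2 ^ k, k + 1, fun n => ?_⟩
  have hn : (0 : ℝ) ≤ n := n.cast_nonneg
  have h1 := h (n + 1)
  push_cast at h1
  have h2 : ((n : ℝ) + 1 + 1) ^ k ≤ (2 * (n + 1)) ^ k := by gcongr; linarith
  rw [_root_.derivCoeff, abs_mul, abs_of_nonneg (by positivity : (0 : ℝ) ≤ n + 1)]
  calc ((n : ℝ) + 1) * |u (n + 1)| ≤ (n + 1) * (K * (2 * (n + 1)) ^ k) := by
        gcongr; exact h1.trans (by gcongr)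
    _ = K * 2 ^ k * (n + 1) ^ (k + 1) := by rw [mul_pow]; ring

theorem PolyGrowth.summable_abs {u : ℕ → ℝ} (hu : PolyGrowth u) {r : ℝ} (h0 : 0 < r)
    (h1 : r < 1) : Summable fun n => |u n| * r ^ n := by
  obtain ⟨K, k, h⟩ := hu
  have hs : Summable fun n : ℕ => (n : ℝ) ^ k * r ^ n :=
    summable_pow_mul_geometric_of_norm_lt_one k (by rwa [Real.norm_of_nonneg h0.le])
  have hs' := (((summable_nat_add_iff 1).2 hs).mul_left (K / r))
  refine Summable.of_nonneg_of_le (fun n => by positivity) (fun n => ?_) hs'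
  calc |u n| * r ^ n ≤ K * ((n : ℝ) + 1) ^ k * r ^ n := by gcongr; exact h n
    _ = K / r * (((n + 1 : ℕ) : ℝ) ^ k * r ^ (n + 1)) := by push_cast; field_simp; ring

theorem PolyGrowth.summable {u : ℕ → ℝ} (hu : PolyGrowth u) {x : ℝ} (hx : |x| < 1) :
    Summable fun n => u n * x ^ n := by
  obtain ⟨r, hr, hr1⟩ := exists_between hx
  refine Summable.of_norm_bounded (hu.summable_abs ((abs_nonneg x).trans_lt hr) hr1) fun n => ?_
  rw [norm_mul, norm_pow, Real.norm_eq_abs, Real.norm_eq_abs]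
  gcongr

theorem PolyGrowth.hasSum {u : ℕ → ℝ} (hu : PolyGrowth u) {x : ℝ} (hx : |x| < 1) :
    HasSum (fun n => u n * x ^ n) (powSum u x) := (hu.summable hx).hasSum

theorem hasSum_of_shift {w v : ℕ → ℝ} {x S : ℝ} (h0 : w 0 = 0) (hw : ∀ n, w (n + 1) = v n)
    (h : HasSum (fun n => v n * x ^ n) S) : HasSum (fun n => w n * x ^ n) (x * S) := by
  rw [← hasSum_nat_add_iff' 1]
  simp only [Finset.range_one, Finset.sum_singleton, h0, zero_mul, sub_zero]
  refine (h.mul_left x).congr_fun ?_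
  intro n
  rw [hw]; ring

theorem PolyGrowth.hasDerivAt {u : ℕ → ℝ} (hu : PolyGrowth u) {x : ℝ} (hx : |x| < 1) :
    HasDerivAt (powSum u) (powSum (_root_.derivCoeff u) x) x := by
  obtain ⟨r, hr, hr1⟩ := exists_between hx
  have hr0 := (abs_nonneg x).trans_lt hr
  have hbd : Summable fun n : ℕ => (n : ℝ) * |u n| * r ^ (n - 1) := by
    rw [← summable_nat_add_iff 1]
    refine (hu.derivCoeff.summable_abs hr0 hr1).congr fun n => ?_
    rw [_root_.derivCoeff, abs_mul, abs_of_nonneg (by positivity : (0 : ℝ) ≤ n + 1)]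
    simp
  have key := hasDerivAt_tsum_of_isPreconnected (g := fun n z => u n * z ^ n)
    (g' := fun n z => u n * (n * z ^ (n - 1))) hbd Metric.isOpen_ball
    (convex_ball (0 : ℝ) r).isPreconnected
    (fun n y _ => (hasDerivAt_pow n y).const_mul (u n))
    (fun n y hy => ?_) (Metric.mem_ball_self hr0) (hu.summable (by simp))
    (y := x) (by simpa using hr)
  · refine key.congr_deriv ?_
    have hs : Summable fun n : ℕ => u n * (n * x ^ (n - 1)) := by
      rw [← summable_nat_add_iff 1]
      refine (hu.derivCoeff.summable hx).congr fun n => ?_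
      simp [_root_.derivCoeff]; ring
    rw [hs.tsum_eq_zero_add]
    simp only [Nat.cast_zero, zero_mul, mul_zero, zero_add, powSum, _root_.derivCoeff]
    refine tsum_congr fun n => ?_
    push_cast [Nat.add_sub_cancel]; ring
  · have hy' : |y| < r := by simpa using hy
    rw [norm_mul, norm_mul, norm_pow, Real.norm_eq_abs, Real.norm_eq_abs, Real.norm_eq_abs,
      Nat.abs_cast]
    calc |u n| * (n * |y| ^ (n - 1)) = n * |u n| * |y| ^ (n - 1) := by ring
      _ ≤ n * |u n| * r ^ (n - 1) := by gcongr

theorem powSum_zero (u : ℕ → ℝ) : powSum u 0 = u 0 := by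
  rw [powSum, tsum_eq_single 0 (fun n hn => by simp [hn])]; simp

/-- A power series whose coefficients converge to `L` is asymptotic to `L / (1 - x)` at `1`. -/
theorem PolyGrowth.tendsto_one_sub_mul_powSum {u : ℕ → ℝ} (hu : PolyGrowth u) {L : ℝ}
    (hL : Tendsto u atTop (𝓝 L)) :
    Tendsto (fun x => (1 - x) * powSum u x) (𝓝[<] 1) (𝓝 L) := by
  set w : ℕ → ℝ := fun n => n.casesOn 0 u with hw
  have hsum : Tendsto (fun n => ∑ i ∈ Finset.range n, (u i - w i)) atTop (𝓝 L) := by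
    rw [← tendsto_add_atTop_iff_nat 1]
    refine hL.congr fun n => ?_
    induction n with
    | zero => simp [hw]
    | succ n ih => rw [Finset.sum_range_succ, ← ih]; simp [hw]
  refine (Real.tendsto_tsum_powerSeries_nhdsWithin_lt hsum).congr' ?_
  filter_upwards [Ioo_mem_nhdsLT (show (0 : ℝ) < 1 by norm_num)] with x hx
  have hx' : |x| < 1 := by rw [abs_of_pos hx.1]; exact hx.2
  have h1 := hu.hasSum hx'
  have h2 := hasSum_of_shift (w := w) rfl (fun _ => rfl) h1
  have h3 : HasSum (fun n => (u n - w n) * x ^ n) (powSum u x - x * powSum u x) := by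
    simpa only [sub_mul] using h1.sub h2
  rw [h3.tsum_eq]
  ring

/-- The coefficients of the Gauss hypergeometric series `₂F₁(a, b; c; x)`. -/
noncomputable def hypCoeff (a b c : ℝ) (n : ℕ) : ℝ :=
  (ascPochhammer ℝ n).eval a * (ascPochhammer ℝ n).eval b /
    ((ascPochhammer ℝ n).eval c * (n.factorial : ℝ))

theorem hypCoeff_zero (a b c : ℝ) : hypCoeff a b c 0 = 1 := by simp [hypCoeff]

theorem hypCoeff_succ {a b c : ℝ} (hc : 0 < c) (n : ℕ) :
    ((n : ℝ) + 1) * (c + n) * hypCoeff a b c (n + 1) = (a + n) * (b + n) * hypCoeff a b c n := by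
  have hp := ascPochhammer_pos n c hc
  have hcn : 0 < c + n := by positivity
  have hf : (0 : ℝ) < n.factorial := by positivity
  simp only [hypCoeff, ascPochhammer_succ_eval, Nat.factorial_succ]
  push_cast
  field_simp

theorem hypCoeff_polyGrowth {a b c : ℝ} (ha : 0 < a) (hb : 0 < b) (hc : 0 < c)
    (h1 : a * b ≤ c) (h2 : a + b ≤ c + 1) : PolyGrowth (hypCoeff a b c) := by
  have hpos : ∀ n, 0 < hypCoeff a b c n := fun n => by
    have := ascPochhammer_pos n a ha
    have := ascPochhammer_pos n b hb
    have := ascPochhammer_pos n c hc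
    unfold hypCoeff
    positivity
  have hle : ∀ n, hypCoeff a b c n ≤ 1 := fun n => by
    induction n with
    | zero => rw [hypCoeff_zero]
    | succ n ih =>
      refine le_trans ?_ ih
      have hn : (0 : ℝ) ≤ n := n.cast_nonneg
      have hd : 0 < ((n : ℝ) + 1) * (c + n) := by positivity
      refine le_of_mul_le_mul_left ?_ hd
      rw [hypCoeff_succ hc]
      refine mul_le_mul_of_nonneg_right ?_ (hpos n).le
      nlinarith
  exact ⟨1, 0, fun n => by simpa [abs_of_pos (hpos n)] using hle n⟩

theorem ascPochhammer_eval_eq_prod (a : ℝ) (n : ℕ) :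
    (ascPochhammer ℝ n).eval a = ∏ j ∈ Finset.range n, (a + j) := by
  induction n with
  | zero => simp
  | succ n ih => rw [ascPochhammer_succ_eval, Finset.prod_range_succ, ih]

theorem tendsto_derivCoeff_hypCoeff {a b : ℝ} (ha : 0 < a) (hb : 0 < b) :
    Tendsto (derivCoeff (hypCoeff a b (a + b))) atTop
      (𝓝 (Real.Gamma (a + b) / (Real.Gamma a * Real.Gamma b))) := by
  have hlim := (Real.GammaSeq_tendsto_Gamma (a + b)).div
    ((Real.GammaSeq_tendsto_Gamma a).mul (Real.GammaSeq_tendsto_Gamma b))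
    (mul_pos (Real.Gamma_pos_of_pos ha) (Real.Gamma_pos_of_pos hb)).ne'
  refine hlim.congr' ?_
  filter_upwards [eventually_ge_atTop 1] with n hn
  have hn' : (0 : ℝ) < n := by exact_mod_cast hn
  have pa := ascPochhammer_pos (n + 1) a ha
  have pb := ascPochhammer_pos (n + 1) b hb
  have pc := ascPochhammer_pos (n + 1) (a + b) (add_pos ha hb)
  have hf : (0 : ℝ) < n.factorial := by positivity
  have ea := Real.rpow_pos_of_pos hn' a
  have eb := Real.rpow_pos_of_pos hn' b
  simp only [Pi.div_apply, Real.GammaSeq, derivCoeff, hypCoeff, ← ascPochhammer_eval_eq_prod,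
    Real.rpow_add hn', Nat.factorial_succ]
  push_cast
  field_simp

theorem tendsto_hypCoeff {a b : ℝ} (ha : 0 < a) (hb : 0 < b) :
    Tendsto (hypCoeff a b (a + b)) atTop (𝓝 0) := by
  rw [← tendsto_add_atTop_iff_nat 1]
  have h := (tendsto_derivCoeff_hypCoeff ha hb).mul tendsto_one_div_add_atTop_nhds_zero_nat
  rw [mul_zero] at h
  refine h.congr fun n => ?_
  have : (n : ℝ) + 1 ≠ 0 := by positivity
  simp only [derivCoeff]
  field_simp

theorem powSum_hypCoeff_ode {a b c x : ℝ} (hc : 0 < c) (hu : PolyGrowth (hypCoeff a b c))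
    (hx : |x| < 1) :
    x * (1 - x) * powSum (derivCoeff (derivCoeff (hypCoeff a b c))) x
      + (c - (a + b + 1) * x) * powSum (derivCoeff (hypCoeff a b c)) x
      = a * b * powSum (hypCoeff a b c) x := by
  set u := hypCoeff a b c with hu_def
  have s0 := hu.hasSum hx
  have s1 := hu.derivCoeff.hasSum hx
  have s2 := hu.derivCoeff.derivCoeff.hasSum hx
  have t1 := hasSum_of_shift (w := fun n => n * u n) (by simp)
    (fun n => by simp [derivCoeff]) s1
  have t2 := hasSum_of_shift (w := fun n => n * derivCoeff u n) (by simp)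
    (fun n => by simp [derivCoeff]) s2
  have t3 := hasSum_of_shift (w := fun n => n * (n - 1) * u n) (by simp)
    (fun n => by simp [derivCoeff]; ring) t2
  have hsum := (((t2.sub t3).add (s1.mul_left c)).sub (t1.mul_left (a + b + 1))).sub
    (s0.mul_left (a * b))
  have hzero := hsum.unique (hasSum_zero.congr_fun fun n => ?_)
  · linarith
  · have := hypCoeff_succ (a := a) (b := b) hc n
    rw [← hu_def] at this
    simp only [derivCoeff]
    linear_combination (x ^ n) * this

/-- `y` solves the hypergeometric equation with parameters `a, b, a + b` on `(0, 1)`, with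
derivative `y'`. -/
def SolvesHypODE (a b : ℝ) (y y' : ℝ → ℝ) : Prop :=
  ∀ x ∈ Ioo (0 : ℝ) 1, HasDerivAt y (y' x) x ∧ ∃ d, HasDerivAt y' d x ∧
    x * (1 - x) * d + (a + b - (a + b + 1) * x) * y' x = a * b * y x

theorem SolvesHypODE.wronskian_const {a b : ℝ} {y y' z z' : ℝ → ℝ} (hy : SolvesHypODE a b y y')
    (hz : SolvesHypODE a b z z') :
    ∃ k, ∀ x ∈ Ioo (0 : ℝ) 1, x ^ (a + b) * (1 - x) * (y x * z' x - z x * y' x) = k := by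
  have hd : ∀ x ∈ Ioo (0 : ℝ) 1,
      HasDerivAt (fun x => x ^ (a + b) * (1 - x) * (y x * z' x - z x * y' x)) 0 x := by
    intro x hx
    obtain ⟨hy1, d, hy2, ey⟩ := hy x hx
    obtain ⟨hz1, e, hz2, ez⟩ := hz x hx
    have hp := Real.hasDerivAt_rpow_const (p := a + b) (Or.inl hx.1.ne')
    have hq := (hasDerivAt_id x).const_sub 1
    refine ((hp.mul hq).mul ((hy1.mul hz2).sub (hz1.mul hy2))).congr_deriv ?_
    have hr : x ^ (a + b) = x ^ (a + b - 1) * x := by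
      rw [← Real.rpow_add_one hx.1.ne']; ring_nf
    simp only [id, Pi.mul_apply, Pi.sub_apply, hr]
    linear_combination x ^ (a + b - 1) * (y x * ez - z x * ey)
  exact isOpen_Ioo.exists_is_const_of_deriv_eq_zero isPreconnected_Ioo
    (fun x hx => (hd x hx).differentiableAt.differentiableWithinAt) (fun x hx => (hd x hx).deriv)

theorem SolvesHypODE.wronskian_eq {a b k : ℝ} {y y' z z' : ℝ → ℝ} {l : Filter ℝ} [l.NeBot]
    (hy : SolvesHypODE a b y y') (hz : SolvesHypODE a b z z') (hl : Ioo (0 : ℝ) 1 ∈ l)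
    (hlim : Tendsto (fun x => x ^ (a + b) * (1 - x) * (y x * z' x - z x * y' x)) l (𝓝 k)) :
    ∀ x ∈ Ioo (0 : ℝ) 1, x ^ (a + b) * (1 - x) * (y x * z' x - z x * y' x) = k := by
  obtain ⟨k', hk'⟩ := hy.wronskian_const hz
  have h : Tendsto (fun x => x ^ (a + b) * (1 - x) * (y x * z' x - z x * y' x)) l (𝓝 k') :=
    tendsto_const_nhds.congr' (by filter_upwards [hl] with x hx using (hk' x hx).symm)
  rw [tendsto_nhds_unique hlim h]
  exact hk'

theorem solvesHypODE_zero {a b : ℝ} (hc : 0 < a + b) (hu : PolyGrowth (hypCoeff a b (a + b))) :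
    SolvesHypODE a b (powSum (hypCoeff a b (a + b)))
      (powSum (derivCoeff (hypCoeff a b (a + b)))) := by
  intro x hx
  have hx' : |x| < 1 := by rw [abs_of_pos hx.1]; exact hx.2
  exact ⟨hu.hasDerivAt hx', _, hu.derivCoeff.hasDerivAt hx', powSum_hypCoeff_ode hc hu hx'⟩

theorem solvesHypODE_one {a b : ℝ} (hu : PolyGrowth (hypCoeff a b 1)) :
    SolvesHypODE a b (fun x => powSum (hypCoeff a b 1) (1 - x))
      (fun x => -powSum (derivCoeff (hypCoeff a b 1)) (1 - x)) := by
  intro x hx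
  have hx' : |1 - x| < 1 := by rw [abs_of_pos (by linarith [hx.2])]; linarith [hx.1]
  refine ⟨(hu.hasDerivAt hx').comp_const_sub 1 x, _,
    ((hu.derivCoeff.hasDerivAt hx').comp_const_sub 1 x).neg, ?_⟩
  have := powSum_hypCoeff_ode one_pos hu hx'
  linear_combination this

theorem solvesHypODE_rpow {a b : ℝ} (hc : 0 < (1 - a) + (1 - b))
    (hu : PolyGrowth (hypCoeff (1 - a) (1 - b) ((1 - a) + (1 - b)))) :
    SolvesHypODE a b
      (fun x => x ^ (1 - a - b) * powSum (hypCoeff (1 - a) (1 - b) ((1 - a) + (1 - b))) x)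
      (fun x => (1 - a - b) * x ^ (-a - b) *
          powSum (hypCoeff (1 - a) (1 - b) ((1 - a) + (1 - b))) x
        + x ^ (1 - a - b) *
          powSum (derivCoeff (hypCoeff (1 - a) (1 - b) ((1 - a) + (1 - b)))) x) := by
  intro x hx
  have hx' : |x| < 1 := by rw [abs_of_pos hx.1]; exact hx.2
  have g0 := hu.hasDerivAt hx'
  have g1 := hu.derivCoeff.hasDerivAt hx'
  have r0 : HasDerivAt (fun x : ℝ => x ^ (1 - a - b)) ((1 - a - b) * x ^ (-a - b)) x := by
    refine (Real.hasDerivAt_rpow_const (Or.inl hx.1.ne')).congr_deriv ?_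
    ring_nf
  have r1 : HasDerivAt (fun x : ℝ => x ^ (-a - b)) ((-a - b) * x ^ (-a - b - 1)) x :=
    Real.hasDerivAt_rpow_const (Or.inl hx.1.ne')
  refine ⟨r0.mul g0, _, ((r1.const_mul (1 - a - b)).mul g0).add (r0.mul g1), ?_⟩
  have ode := powSum_hypCoeff_ode hc hu hx'
  have e1 : x ^ (-a - b) = x ^ (-a - b - 1) * x := by
    rw [← Real.rpow_add_one hx.1.ne']; ring_nf
  have e2 : x ^ (1 - a - b) = x ^ (-a - b - 1) * x * x := by
    rw [← Real.rpow_add_one hx.1.ne', ← Real.rpow_add_one hx.1.ne']; ring_nf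
  simp only [e1, e2]
  linear_combination (x ^ (-a - b - 1) * x * x) * ode

/-- The connection formula between the hypergeometric solutions at `0` and `1`, in real form. -/
theorem hyp_connection_real {a b : ℝ} (ha : a ∈ Ioo (0 : ℝ) 1) (hb : b ∈ Ioo (0 : ℝ) 1) {t : ℝ}
    (ht : t ∈ Ioo (0 : ℝ) 1) :
    (1 - a - b) * powSum (hypCoeff a b 1) (1 - t)
      = Real.Gamma ((1 - a) + (1 - b)) / (Real.Gamma (1 - a) * Real.Gamma (1 - b)) *
          powSum (hypCoeff a b (a + b)) t
        - Real.Gamma (a + b) / (Real.Gamma a * Real.Gamma b) *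
          (t ^ (1 - a - b) * powSum (hypCoeff (1 - a) (1 - b) ((1 - a) + (1 - b))) t) := by
  obtain ⟨ha0, ha1⟩ := ha
  obtain ⟨hb0, hb1⟩ := hb
  have ha' : 0 < 1 - a := by linarith
  have hb' : 0 < 1 - b := by linarith
  have P1 : PolyGrowth (hypCoeff a b (a + b)) :=
    hypCoeff_polyGrowth ha0 hb0 (by linarith) (by nlinarith) (by linarith)
  have P2 : PolyGrowth (hypCoeff a b 1) :=
    hypCoeff_polyGrowth ha0 hb0 one_pos (by nlinarith) (by linarith)
  have P3 : PolyGrowth (hypCoeff (1 - a) (1 - b) ((1 - a) + (1 - b))) :=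
    hypCoeff_polyGrowth ha' hb' (by linarith) (by nlinarith) (by linarith)
  have S1 := solvesHypODE_zero (add_pos ha0 hb0) P1
  have S2 := solvesHypODE_one P2
  have S3 := solvesHypODE_rpow (add_pos ha' hb') P3
  have l1 := P1.tendsto_one_sub_mul_powSum (tendsto_hypCoeff ha0 hb0)
  have l1' := P1.derivCoeff.tendsto_one_sub_mul_powSum (tendsto_derivCoeff_hypCoeff ha0 hb0)
  have l3 := P3.tendsto_one_sub_mul_powSum (tendsto_hypCoeff ha' hb')
  have l3' := P3.derivCoeff.tendsto_one_sub_mul_powSum (tendsto_derivCoeff_hypCoeff ha' hb')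
  have cont0 : ∀ {u : ℕ → ℝ}, PolyGrowth u → Tendsto (powSum u) (𝓝 0) (𝓝 (u 0)) := by
    intro u hu
    rw [← powSum_zero u]
    exact (hu.hasDerivAt (by simp)).continuousAt.tendsto
  have to0 : Tendsto (fun x : ℝ => 1 - x) (𝓝[<] 1) (𝓝 0) := by
    have : Tendsto (fun x : ℝ => 1 - x) (𝓝 1) (𝓝 (1 - 1)) := tendsto_const_nhds.sub tendsto_id
    rw [sub_self] at this
    exact this.mono_left nhdsWithin_le_nhds
  have rp : ∀ p : ℝ, Tendsto (fun x : ℝ => x ^ p) (𝓝[<] 1) (𝓝 1) := fun p => by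
    have := (Real.continuousAt_rpow_const 1 p (Or.inl one_ne_zero)).tendsto
    rw [Real.one_rpow] at this
    exact this.mono_left nhdsWithin_le_nhds
  have l2 := (cont0 P2).comp to0
  have l2' := (cont0 P2.derivCoeff).comp to0
  rw [hypCoeff_zero] at l2
  have W12 := S1.wronskian_eq S2 (l := 𝓝[<] 1)
    (k := -(Real.Gamma (a + b) / (Real.Gamma a * Real.Gamma b))) (Ioo_mem_nhdsLT one_pos) (by
      have := (rp (a + b)).mul ((l1.mul l2'.neg).sub (l2.mul l1'))
      refine (this.congr fun x => ?_).trans (le_of_eq ?_)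
      · simp only [Function.comp_apply]; ring
      · congr 1; ring)
  have W23 := S2.wronskian_eq S3 (l := 𝓝[<] 1)
    (k := Real.Gamma ((1 - a) + (1 - b)) / (Real.Gamma (1 - a) * Real.Gamma (1 - b)))
    (Ioo_mem_nhdsLT one_pos) (by
      have := (rp (a + b)).mul ((l2.mul ((((rp (-a - b)).const_mul (1 - a - b)).mul l3).add
        ((rp (1 - a - b)).mul l3'))).sub (((rp (1 - a - b)).mul l3).mul l2'.neg))
      refine (this.congr fun x => ?_).trans (le_of_eq ?_)
      · simp only [Function.comp_apply]; ring
      · congr 1; ring)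
  have W13 := S1.wronskian_eq S3 (l := 𝓝[>] 0) (k := 1 - a - b) (Ioo_mem_nhdsGT one_pos) (by
    have c1 := cont0 P1
    have c1' := cont0 P1.derivCoeff
    have c3 := cont0 P3
    have c3' := cont0 P3.derivCoeff
    rw [hypCoeff_zero] at c1 c3
    have id0 : Tendsto (fun x : ℝ => x) (𝓝 0) (𝓝 0) := tendsto_id
    have := ((id0.const_sub 1).mul ((c1.mul ((c3.const_mul (1 - a - b)).add (id0.mul c3'))).sub
      ((id0.mul c3).mul c1'))).mono_left (nhdsWithin_le_nhds (s := Ioi 0))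
    refine (this.congr' ?_).trans (le_of_eq ?_)
    · filter_upwards [self_mem_nhdsWithin] with x hx
      have hx : 0 < x := hx
      have e1 : x ^ (1 - a - b) = x ^ (-a - b) * x := by
        rw [← Real.rpow_add_one hx.ne']; ring_nf
      have e2 : x ^ (a + b) * x ^ (-a - b) = 1 := by
        rw [← Real.rpow_add hx]; ring_nf; exact Real.rpow_zero x
      rw [e1]
      set y1 := powSum (hypCoeff a b (a + b)) x
      set y1' := powSum (derivCoeff (hypCoeff a b (a + b))) x
      set y3 := powSum (hypCoeff (1 - a) (1 - b) ((1 - a) + (1 - b))) x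
      set y3' := powSum (derivCoeff (hypCoeff (1 - a) (1 - b) ((1 - a) + (1 - b)))) x
      linear_combination
        (-(1 - x) * (y1 * ((1 - a - b) * y3 + x * y3') - x * y3 * y1')) * e2
    · congr 1; ring)
  linear_combination -powSum (hypCoeff a b 1) (1 - t) * W13 t ht
    + powSum (hypCoeff a b (a + b)) t * W23 t ht
    + t ^ (1 - a - b) * powSum (hypCoeff (1 - a) (1 - b) ((1 - a) + (1 - b))) t * W12 t ht

theorem hyp2F1C_ofReal (a b c x : ℝ) :
    hyp2F1C a b c x = ((powSum (hypCoeff a b c) x : ℝ) : ℂ) := by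
  have h : ∀ (a : ℝ) (n : ℕ), pochC a n = (((ascPochhammer ℝ n).eval a : ℝ) : ℂ) := by
    intro a n
    induction n with
    | zero => simp [pochC]
    | succ n ih =>
      rw [pochC] at ih ⊢
      rw [ascPochhammer_succ_eval, ascPochhammer_succ_eval, ih]
      push_cast; rfl
  simp only [hyp2F1C, powSum, hypCoeff, h]
  push_cast
  rfl

theorem betaC_ofReal (a b : ℝ) :
    betaC a b = ((Real.Gamma a * Real.Gamma b / Real.Gamma (a + b) : ℝ) : ℂ) := by
  rw [betaC, ← Complex.ofReal_add]
  simp only [Complex.Gamma_ofReal]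
  push_cast
  rfl

theorem one_sub_exp_two_pi_mul_I (z : ℂ) :
    1 - exp (2 * Real.pi * I * z) = -2 * I * exp (Real.pi * z * I) * sin (Real.pi * z) := by
  have h1 : exp (2 * Real.pi * I * z) = exp (Real.pi * z * I) * exp (Real.pi * z * I) := by
    rw [← Complex.exp_add]; ring_nf
  have h2 : exp (-(Real.pi * z) * I) * exp (Real.pi * z * I) = 1 := by
    rw [← Complex.exp_add]; simp
  rw [h1, Complex.sin]
  linear_combination (exp (Real.pi * z * I) * exp (-(Real.pi * z) * I)
    - exp (Real.pi * z * I) ^ 2) * Complex.I_mul_I - h2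

theorem exp_ratio_eq {a b : ℝ} (ha : a ∈ Ioo (0 : ℝ) 1) (hb : b ∈ Ioo (0 : ℝ) 1) :
    2 * Real.pi * I * ((1 - exp (2 * Real.pi * I * ((a : ℂ) + b))) /
      ((1 - exp (2 * Real.pi * I * (a : ℂ))) * (1 - exp (2 * Real.pi * I * (b : ℂ)))))
    = ((-(Real.pi * Real.sin (Real.pi * (a + b)) /
        (Real.sin (Real.pi * a) * Real.sin (Real.pi * b))) : ℝ) : ℂ) := by
  have hs : ∀ {x : ℝ}, x ∈ Ioo (0 : ℝ) 1 → sin (Real.pi * (x : ℂ)) ≠ 0 := by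
    intro x hx
    have : 0 < Real.sin (Real.pi * x) := Real.sin_pos_of_pos_of_lt_pi
      (mul_pos Real.pi_pos hx.1) (by nlinarith [hx.2, Real.pi_pos])
    exact_mod_cast this.ne'
  have h1 := hs ha
  have h2 := hs hb
  simp only [one_sub_exp_two_pi_mul_I]
  push_cast
  have e : exp (Real.pi * ((a : ℂ) + b) * I) = exp (Real.pi * a * I) * exp (Real.pi * b * I) := by
    rw [← Complex.exp_add]; ring_nf
  have := Complex.exp_ne_zero (Real.pi * a * I)
  have := Complex.exp_ne_zero (Real.pi * b * I)
  have := Complex.I_ne_zero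
  rw [e]
  field_simp

theorem gamma_prod_eq {a b : ℝ} (ha : a ∈ Ioo (0 : ℝ) 1) (hb : b ∈ Ioo (0 : ℝ) 1)
    (hab : a + b ≠ 1) :
    Real.Gamma a * Real.Gamma b / Real.Gamma (a + b) *
      (Real.Gamma (1 - a) * Real.Gamma (1 - b) / Real.Gamma ((1 - a) + (1 - b))) * (1 - a - b)
    = Real.pi * Real.sin (Real.pi * (a + b)) /
        (Real.sin (Real.pi * a) * Real.sin (Real.pi * b)) := by
  have hs : Real.Gamma ((1 - a) + (1 - b)) = (1 - a - b) * Real.Gamma (1 - (a + b)) := by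
    rw [show (1 - a) + (1 - b) = (1 - a - b) + 1 by ring,
      Real.Gamma_add_one (fun h => hab (by linarith)), sub_sub]
  have h0 : 1 - a - b ≠ 0 := fun h => hab (by linarith)
  have g1 : Real.Gamma (a + b) ≠ 0 := (Real.Gamma_pos_of_pos (add_pos ha.1 hb.1)).ne'
  have g2 : Real.Gamma ((1 - a) + (1 - b)) ≠ 0 :=
    (Real.Gamma_pos_of_pos (by linarith [ha.2, hb.2])).ne'
  have g3 : Real.Gamma (1 - (a + b)) ≠ 0 := fun h => g2 (by rw [hs, h, mul_zero])
  have ea := Real.Gamma_mul_Gamma_one_sub a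
  have eb := Real.Gamma_mul_Gamma_one_sub b
  have es := Real.Gamma_mul_Gamma_one_sub (a + b)
  have hsin : Real.sin (Real.pi * (a + b)) ≠ 0 := fun h =>
    mul_ne_zero g1 g3 (by rw [es, h, div_zero])
  calc _ = (Real.Gamma a * Real.Gamma (1 - a)) * (Real.Gamma b * Real.Gamma (1 - b)) /
        (Real.Gamma (a + b) * Real.Gamma (1 - (a + b))) := by rw [hs]; field_simp
    _ = _ := by
      rw [ea, eb, es]
      have := Real.pi_ne_zero
      field_simp

/-- for `α, β ∈ (0,1)` with `α + β ≠ 1` and `t ∈ (0,1)`, the three-term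
linear relation between Kummer's solutions `f₁, f₂, f₃` holds. -/
theorem stmt5 (α β : ℝ) (hα : α ∈ Ioo (0 : ℝ) 1) (hβ : β ∈ Ioo (0 : ℝ) 1)
    (hαβ : α + β ≠ 1) :
    ∀ t ∈ Ioo (0 : ℝ) 1,
      betaC α β * hyp2F1C α β ((α : ℂ) + β) (t : ℂ)
        + 2 * Real.pi * Complex.I *
          ((1 - Complex.exp (2 * Real.pi * Complex.I * ((α : ℂ) + β))) /
            ((1 - Complex.exp (2 * Real.pi * Complex.I * (α : ℂ))) *
              (1 - Complex.exp (2 * Real.pi * Complex.I * (β : ℂ))))) *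
          hyp2F1C α β 1 (1 - (t : ℂ))
        - betaC (1 - (α : ℂ)) (1 - (β : ℂ)) * ((t ^ (1 - α - β) : ℝ) : ℂ) *
          hyp2F1C (1 - (α : ℂ)) (1 - (β : ℂ)) (2 - (α : ℂ) - β) (t : ℂ) = 0 := by
  intro t ht
  have f1 := hyp2F1C_ofReal α β (α + β) t
  have f2 := hyp2F1C_ofReal α β 1 (1 - t)
  have f3 := hyp2F1C_ofReal (1 - α) (1 - β) ((1 - α) + (1 - β)) t
  have b2 := betaC_ofReal (1 - α) (1 - β)
  rw [show (((1 - α) + (1 - β) : ℝ) : ℂ) = 2 - (α : ℂ) - β by push_cast; ring] at f3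
  simp only [ofReal_add, ofReal_sub, ofReal_one] at f1 f2 f3 b2
  rw [exp_ratio_eq hα hβ, betaC_ofReal α β, b2, f1, f2, f3, ← gamma_prod_eq hα hβ hαβ]
  norm_cast
  have key := hyp_connection_real hα hβ ht
  have g1 := (Real.Gamma_pos_of_pos hα.1).ne'
  have g2 := (Real.Gamma_pos_of_pos hβ.1).ne'
  have g3 := (Real.Gamma_pos_of_pos (sub_pos.2 hα.2)).ne'
  have g4 := (Real.Gamma_pos_of_pos (sub_pos.2 hβ.2)).ne'
  have g5 := (Real.Gamma_pos_of_pos (add_pos hα.1 hβ.1)).ne'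
  have g6 := (Real.Gamma_pos_of_pos (add_pos (sub_pos.2 hα.2) (sub_pos.2 hβ.2))).ne'
  rw [neg_mul, mul_assoc _ (1 - α - β), key]
  field_simp
  ring
end

section
/- Let α, β ∈ (0,1) and ν > 0 be real numbers, and let x be a real number with |x| < 1. Then the integral ∫₀¹ (1−u)^{ν−1}·₂F₁(α, β; 1; xu) du converges and equals (1/ν)·₂F₁(α, β; ν+1; x). -/
open Set MeasureTheory

/-- Pochhammer symbol `(a)_n` for real `a`. -/
noncomputable def poch (a : ℝ) (n : ℕ) : ℝ := (ascPochhammer ℝ n).eval a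

/-- Gauss hypergeometric function `₂F₁(a,b;c;x)` as a series (real version). -/
noncomputable def hyp2F1 (a b c x : ℝ) : ℝ :=
  ∑' n : ℕ, poch a n * poch b n / (poch c n * (n.factorial : ℝ)) * x ^ n

lemma poch_succ (a : ℝ) (n : ℕ) : poch a (n + 1) = poch a n * (a + n) :=
  ascPochhammer_succ_eval n a

lemma poch_pos {a : ℝ} (ha : 0 < a) (n : ℕ) : 0 < poch a n :=
  ascPochhammer_pos n a ha

lemma poch_one (n : ℕ) : poch 1 n = n.factorial :=
  ascPochhammer_eval_one ℝ n

lemma poch_le_factorial {a : ℝ} (ha : 0 < a) (ha1 : a ≤ 1) (n : ℕ) :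
    poch a n ≤ n.factorial := by
  rw [← poch_one]
  induction n with
  | zero => simp [poch]
  | succ n ih =>
    rw [poch_succ, poch_succ]
    have := poch_pos one_pos n
    gcongr

lemma poch_eq_prod (a : ℝ) (n : ℕ) : poch a n = ∏ j ∈ Finset.range n, (a + j) := by
  induction n with
  | zero => simp [poch]
  | succ n ih => rw [poch_succ, ih, Finset.prod_range_succ]

/-- The Taylor coefficients of `₂F₁(a,b;1;·)` are bounded by one in absolute value
when `a, b ∈ (0,1]`. -/
lemma abs_hyp2F1_coeff_le_one {a b : ℝ} (ha : 0 < a) (ha1 : a ≤ 1) (hb : 0 < b) (hb1 : b ≤ 1)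
    (n : ℕ) : |poch a n * poch b n / (poch 1 n * (n.factorial : ℝ))| ≤ 1 := by
  have hp := poch_pos ha n
  have hq := poch_pos hb n
  have hf : (0 : ℝ) < n.factorial := by positivity
  rw [poch_one, abs_of_nonneg (by positivity), div_le_one (by positivity)]
  exact mul_le_mul (poch_le_factorial ha ha1 n) (poch_le_factorial hb hb1 n) hq.le hf.le

lemma intervalIntegrable_one_sub_rpow {ν : ℝ} (hν : 0 < ν) :
    IntervalIntegrable (fun u : ℝ => (1 - u) ^ (ν - 1)) volume 0 1 := by
  have h := (intervalIntegral.intervalIntegrable_rpow' (a := 0) (b := 1)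
    (show -1 < ν - 1 by linarith)).comp_sub_left 1
  simpa using h.symm

/-- The Beta integral `B(n+1, ν)`. -/
lemma integral_one_sub_rpow_mul_pow {ν : ℝ} (hν : 0 < ν) (n : ℕ) :
    ∫ u in (0 : ℝ)..1, (1 - u) ^ (ν - 1) * u ^ n = n.factorial / (ν * poch (ν + 1) n) := by
  have h := Complex.betaIntegral_eval_nat_add_one_right (u := (ν : ℂ)) (by simpa using hν) n
  rw [← Complex.betaIntegral_symm, Complex.betaIntegral] at h
  have hint : ∫ u in (0 : ℝ)..1, (u : ℂ) ^ ((n : ℂ) + 1 - 1) * (1 - (u : ℂ)) ^ ((ν : ℂ) - 1)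
      = ((∫ u in (0 : ℝ)..1, (1 - u) ^ (ν - 1) * u ^ n : ℝ) : ℂ) := by
    rw [← intervalIntegral.integral_ofReal]
    refine intervalIntegral.integral_congr fun u hu => ?_
    rw [uIcc_of_le zero_le_one] at hu
    have h1 : 0 ≤ 1 - u := by linarith [hu.2]
    simp only [add_sub_cancel_right, Complex.cpow_natCast]
    push_cast [Complex.ofReal_cpow h1]
    ring
  have hprod : ν * poch (ν + 1) n = ∏ j ∈ Finset.range (n + 1), (ν + j) := by
    rw [poch_eq_prod, Finset.prod_range_succ', mul_comm]
    simp [add_assoc, add_comm (1 : ℝ)]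
  rw [hint] at h
  rw [hprod]
  exact_mod_cast h

/-- for `α, β ∈ (0,1)`, `ν > 0` and `|x| < 1`,
`∫₀¹ (1−u)^{ν−1}·₂F₁(α,β;1;xu) du` converges and equals `(1/ν)·₂F₁(α,β;ν+1;x)`. -/
theorem stmt7 (α β ν x : ℝ) (hα : α ∈ Ioo (0 : ℝ) 1) (hβ : β ∈ Ioo (0 : ℝ) 1)
    (hν : 0 < ν) (hx : |x| < 1) :
    IntervalIntegrable (fun u => (1 - u) ^ (ν - 1) * hyp2F1 α β 1 (x * u))
      volume 0 1 ∧
    ∫ u in (0 : ℝ)..1, (1 - u) ^ (ν - 1) * hyp2F1 α β 1 (x * u)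
      = (1 / ν) * hyp2F1 α β (ν + 1) x := by
  set c : ℕ → ℝ := fun n => poch α n * poch β n / (poch 1 n * (n.factorial : ℝ)) with hc
  have hc1 : ∀ n, |c n| ≤ 1 := abs_hyp2F1_coeff_le_one hα.1 hα.2.le hβ.1 hβ.2.le
  have hgeo : Summable fun n : ℕ => |x| ^ n := summable_geometric_of_lt_one (abs_nonneg x) hx
  have hterm : ∀ n, ∀ u ∈ Icc (0 : ℝ) 1, ‖c n * (x * u) ^ n‖ ≤ |x| ^ n := by
    intro n u hu
    have hxu : |x * u| ≤ |x| := by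
      rw [abs_mul, abs_of_nonneg hu.1]
      exact mul_le_of_le_one_right (abs_nonneg x) hu.2
    rw [Real.norm_eq_abs, abs_mul, abs_pow]
    calc |c n| * |x * u| ^ n ≤ 1 * |x| ^ n := by gcongr; exact hc1 n
      _ = |x| ^ n := one_mul _
  have hcont : ContinuousOn (fun u => hyp2F1 α β 1 (x * u)) (Icc 0 1) :=
    continuousOn_tsum (fun n => by fun_prop) hgeo hterm
  have hw := intervalIntegrable_one_sub_rpow hν
  refine ⟨hw.mul_continuousOn (by rwa [uIcc_of_le zero_le_one]), ?_⟩
  have hmem : ∀ u ∈ uIoc (0 : ℝ) 1, u ∈ Icc (0 : ℝ) 1 := fun u hu => by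
    rw [uIoc_of_le zero_le_one] at hu
    exact Ioc_subset_Icc_self hu
  have hsum := intervalIntegral.hasSum_integral_of_dominated_convergence (μ := volume)
    (a := 0) (b := 1)
    (F := fun n u => (1 - u) ^ (ν - 1) * (c n * (x * u) ^ n))
    (f := fun u => (1 - u) ^ (ν - 1) * hyp2F1 α β 1 (x * u))
    (fun n u => (1 - u) ^ (ν - 1) * |x| ^ n)
    (fun n => (hw.mul_continuousOn
      (g := fun u => c n * (x * u) ^ n) (by fun_prop)).def'.aestronglyMeasurable)
    (fun n => .of_forall fun u hu => by
      have h1 : 0 ≤ 1 - u := by linarith [(hmem u hu).2]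
      rw [norm_mul, Real.norm_of_nonneg (Real.rpow_nonneg h1 _)]
      exact mul_le_mul_of_nonneg_left (hterm n u (hmem u hu)) (Real.rpow_nonneg h1 _))
    (.of_forall fun u _ => hgeo.mul_left _)
    (by simpa only [tsum_mul_left] using hw.mul_const _)
    (.of_forall fun u hu =>
      (Summable.of_norm_bounded hgeo fun n => hterm n u (hmem u hu)).hasSum.mul_left _)
  rw [← hsum.tsum_eq, hyp2F1, ← tsum_mul_left]
  refine tsum_congr fun n => ?_
  calc ∫ u in (0 : ℝ)..1, (1 - u) ^ (ν - 1) * (c n * (x * u) ^ n)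
      = ∫ u in (0 : ℝ)..1, c n * x ^ n * ((1 - u) ^ (ν - 1) * u ^ n) := by
        congr 1; ext u; ring
    _ = c n * x ^ n * (n.factorial / (ν * poch (ν + 1) n)) := by
        rw [intervalIntegral.integral_const_mul, integral_one_sub_rpow_mul_pow hν]
    _ = _ := by
        have h1 : poch (ν + 1) n ≠ 0 := (poch_pos (by linarith) n).ne'
        have h2 : (n.factorial : ℝ) ≠ 0 := by positivity
        simp only [hc, poch_one]
        field_simp
end
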